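/- arXiv:2203.12473 — 3 statements merged into one kernel-verified Lean document; each statement's English description precedes it below -/
import Mathlib

section
/- Let ρ : ℝ³ → [0,∞) be measurable, let μ be a radial Borel probability measure on ℝ³ with D(μ,μ) < ∞, and let η be a finite positive Borel measure on ℝ³ with D(η,η) < ∞. Then for every N and all points x₁,…,x_N ∈ ℝ³ with ρ(x_j) > 0 for all j, one has the pointwise bound Σ_{1≤j<k≤N} |x_j−x_k|^{−1} ≥ −D(η,η) + 2 Σ_{j=1}^N D(μ_{x_j}, η) − D(μ,μ) Σ_{j=1}^N ρ(x_j)^{1/3}. -/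
open MeasureTheory ENNReal Set Metric Filter Real Topology
open scoped RealInnerProductSpace

noncomputable section

/-- Three-dimensional Euclidean space. -/
abbrev E3 := EuclideanSpace ℝ (Fin 3)

/-- The Coulomb kernel `|x-y|⁻¹`, valued in `ℝ≥0∞` (equal to `∞` on the diagonal). -/
def coul (x y : E3) : ℝ≥0∞ := (ENNReal.ofReal ‖x - y‖)⁻¹

/-- The Coulomb energy `D(ν₁,ν₂) = (1/2)∬ |x-y|⁻¹ dν₁ dν₂`, valued in `ℝ≥0∞`. -/
def DD (ν₁ ν₂ : Measure E3) : ℝ≥0∞ := 2⁻¹ * ∫⁻ x, ∫⁻ y, coul x y ∂ν₂ ∂ν₁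

/-- The real-valued Coulomb energy `D(ν₁,ν₂)`. -/
def Dr (ν₁ ν₂ : Measure E3) : ℝ := (DD ν₁ ν₂).toReal

/-- A measure on `ℝ³` is radial if it is invariant under all linear isometries
(rotations about the origin). -/
def IsRadial (μ : Measure E3) : Prop := ∀ e : E3 ≃ₗᵢ[ℝ] E3, Measure.map e μ = μ

/-- `μ_{v,a}` : the measure `μ` dilated by `1/a` and recentered at `v`, i.e. the pushforward
of `μ` under `u ↦ v + u/a`. -/
def dilate (μ : Measure E3) (v : E3) (a : ℝ) : Measure E3 :=
  Measure.map (fun u => v + a⁻¹ • u) μ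

/-- The first basis vector `e₁ = (1,0,0)`. -/
def e1 : E3 := EuclideanSpace.single (0 : Fin 3) (1 : ℝ)

/-- `Φ_{μν}(a,b) = a³b³(1 - 2D(μ_{0,a}, ν_{e₁,b}))`, extended by `0` when `a = 0` or `b = 0`. -/
def Phi (μ ν : Measure E3) (a b : ℝ) : ℝ :=
  if 0 < a ∧ 0 < b then a ^ 3 * b ^ 3 * (1 - 2 * Dr (dilate μ 0 a) (dilate ν e1 b)) else 0

/-- `Ψ_{μν} = Φ_{μν} + Φ_{νμ} - Φ_{νν}`. -/
def Psi (μ ν : Measure E3) (a b : ℝ) : ℝ := Phi μ ν a b + Phi ν μ a b - Phi ν ν a b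

/-- `μ_x` : the measure `μ` rescaled to the length scale `ρ(x)^{-1/3}` and recentered at `x`,
i.e. the pushforward of `μ` under `y ↦ x + ρ(x)^{-1/3} y`. -/
def smear (μ : Measure E3) (ρ : E3 → ℝ) (x : E3) : Measure E3 :=
  Measure.map (fun y => x + (ρ x) ^ (-(1:ℝ)/3) • y) μ


lemma lint_plane (G : ℝ → ℝ≥0∞) (hG : Measurable G) :
    ∫⁻ p : ℝ × ℝ, G (p.1 ^ 2 + p.2 ^ 2) = ENNReal.ofReal π * ∫⁻ v in Ioi (0:ℝ), G v := by
  have h1 : ∫⁻ v in Ioi (0:ℝ), G v = ∫⁻ r in Ioi (0:ℝ), ENNReal.ofReal |2 * r| * G (r ^ 2) := by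
    have him : Set.image (fun r : ℝ => r ^ 2) (Ioi 0) = Ioi 0 := by
      ext v
      constructor
      · rintro ⟨r, hr, rfl⟩
        exact pow_pos (mem_Ioi.1 hr) 2
      · intro hv
        exact ⟨√v, Real.sqrt_pos.2 hv, Real.sq_sqrt (le_of_lt hv)⟩
    conv_lhs => rw [← him]
    refine lintegral_image_eq_lintegral_abs_deriv_mul measurableSet_Ioi (fun r _ => ?_) ?_ G
    · have := (hasDerivAt_pow 2 r).hasDerivWithinAt (s := Ioi 0)
      simpa using this
    · intro a ha b hb hab
      have ha' : (0:ℝ) < a := ha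
      have hb' : (0:ℝ) < b := hb
      exact (pow_left_inj₀ ha'.le hb'.le two_ne_zero).1 hab
  rw [← lintegral_comp_polarCoord_symm]
  have h2 : ∀ p : ℝ × ℝ, ENNReal.ofReal p.1 • G ((polarCoord.symm p).1 ^ 2 + (polarCoord.symm p).2 ^ 2)
      = ENNReal.ofReal p.1 * G (p.1 ^ 2) * 1 := by
    intro p
    simp only [polarCoord_symm_apply, smul_eq_mul, mul_one]
    congr 2
    have := Real.sin_sq_add_cos_sq p.2
    linear_combination p.1 ^ 2 * this
  simp_rw [h2]
  have h3 : polarCoord.target = Ioi (0:ℝ) ×ˢ Ioo (-π) π := rfl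
  rw [h3, Measure.volume_eq_prod, ← Measure.prod_restrict,
    lintegral_prod_mul (f := fun r => ENNReal.ofReal r * G (r ^ 2)) (g := fun _ => 1) (by fun_prop) (by fun_prop)]
  rw [h1]
  simp only [lintegral_const, one_mul, Measure.restrict_apply_univ, Real.volume_Ioo]
  have h4 : ∫⁻ r in Ioi (0:ℝ), ENNReal.ofReal |2 * r| * G (r ^ 2)
      = 2 * ∫⁻ r in Ioi (0:ℝ), ENNReal.ofReal r * G (r ^ 2) := by
    rw [← lintegral_const_mul _ (by fun_prop)]
    refine setLIntegral_congr_fun measurableSet_Ioi fun r hr => ?_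
    have hr' : (0:ℝ) < r := hr
    simp only [abs_of_pos (mul_pos two_pos hr'), ENNReal.ofReal_mul zero_le_two, mul_assoc]
    simp
  rw [h4, show π - -π = π * 2 by ring, ENNReal.ofReal_mul Real.pi_pos.le]
  simp only [ENNReal.ofReal_ofNat]
  ring

lemma lint_space (g : ℝ → ℝ → ℝ≥0∞) (hg : Measurable (Function.uncurry g)) :
    ∫⁻ z : E3, g (z 0) (‖z‖ ^ 2) =
      ENNReal.ofReal π * ∫⁻ s : ℝ, ∫⁻ w in Ioi (s ^ 2), g s w := by
  have e1 : ∀ z : E3, g (z 0) (‖z‖ ^ 2) =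
      (fun y : Fin 3 → ℝ => g (y 0) (y 0 ^ 2 + (y 1 ^ 2 + y 2 ^ 2))) (WithLp.ofLp z) := by
    intro z
    simp [EuclideanSpace.real_norm_sq_eq, Fin.sum_univ_three, add_assoc]
  have m1 : Measurable (fun y : Fin 3 → ℝ => g (y 0) (y 0 ^ 2 + (y 1 ^ 2 + y 2 ^ 2))) := by
    exact hg.comp (f := fun y : Fin 3 → ℝ => (y 0, (y 0 ^ 2 + (y 1 ^ 2 + y 2 ^ 2)))) (by fun_prop)
  simp_rw [e1]
  rw [(PiLp.volume_preserving_ofLp (Fin 3)).lintegral_comp m1]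
  have e2 : ∀ y : Fin 3 → ℝ, g (y 0) (y 0 ^ 2 + (y 1 ^ 2 + y 2 ^ 2)) =
      (fun q : ℝ × (Fin 2 → ℝ) => g q.1 (q.1 ^ 2 + (q.2 0 ^ 2 + q.2 1 ^ 2)))
        (MeasurableEquiv.piFinSuccAbove (fun _ : Fin 3 => ℝ) 0 y) := by
    intro y
    rfl
  have m2 : Measurable (fun q : ℝ × (Fin 2 → ℝ) => g q.1 (q.1 ^ 2 + (q.2 0 ^ 2 + q.2 1 ^ 2))) := by
    exact hg.comp (f := fun q : ℝ × (Fin 2 → ℝ) => (q.1, (q.1 ^ 2 + (q.2 0 ^ 2 + q.2 1 ^ 2)))) (by fun_prop)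
  simp_rw [e2]
  rw [(volume_preserving_piFinSuccAbove (fun _ : Fin 3 => ℝ) 0).lintegral_comp m2,
    Measure.volume_eq_prod, lintegral_prod _ m2.aemeasurable]
  have e3 : ∀ s : ℝ, ∫⁻ q : Fin 2 → ℝ, g s (s ^ 2 + (q 0 ^ 2 + q 1 ^ 2)) =
      ENNReal.ofReal π * ∫⁻ w in Ioi (s ^ 2), g s w := by
    intro s
    have m3 : Measurable (fun v : ℝ => g s (s ^ 2 + v)) :=
      hg.comp (f := fun v : ℝ => (s, s ^ 2 + v)) (by fun_prop)
    have m4 : Measurable (fun v : ℝ => g s v) :=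
      hg.comp (f := fun v : ℝ => (s, v)) (by fun_prop)
    have m5 : Measurable (fun p : ℝ × ℝ => g s (s ^ 2 + (p.1 ^ 2 + p.2 ^ 2))) :=
      m3.comp (f := fun p : ℝ × ℝ => p.1 ^ 2 + p.2 ^ 2) (by fun_prop)
    have := (volume_preserving_finTwoArrow ℝ).lintegral_comp m5
    have h' := lint_plane (fun v => g s (s ^ 2 + v)) m3
    rw [← this] at h'
    refine h'.trans ?_
    congr 1
    rw [← lintegral_indicator measurableSet_Ioi, ← lintegral_indicator measurableSet_Ioi,
      ← lintegral_add_left_eq_self ((Ioi (s ^ 2)).indicator fun w => g s w) (s ^ 2)]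
    refine lintegral_congr fun v => ?_
    by_cases hv : 0 < v <;> simp [indicator, hv]
  simp_rw [e3]
  rw [lintegral_const_mul' _ _ ENNReal.ofReal_ne_top]

/-- Swapped version. -/
lemma lint_space' (g : ℝ → ℝ → ℝ≥0∞) (hg : Measurable (Function.uncurry g)) :
    ∫⁻ z : E3, g (z 0) (‖z‖ ^ 2) =
      ENNReal.ofReal π * ∫⁻ w in Ioi (0:ℝ), ∫⁻ s in Ioo (-√w) (√w), g s w := by
  rw [lint_space g hg]
  congr 1
  have hS : MeasurableSet {p : ℝ × ℝ | p.1 ^ 2 < p.2} :=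
    measurableSet_lt (by fun_prop) (by fun_prop)
  have hm : Measurable ({p : ℝ × ℝ | p.1 ^ 2 < p.2}.indicator (Function.uncurry g)) := hg.indicator hS
  have e1 : ∀ s : ℝ, ∫⁻ w in Ioi (s ^ 2), g s w =
      ∫⁻ w, {p : ℝ × ℝ | p.1 ^ 2 < p.2}.indicator (Function.uncurry g) (s, w) := by
    intro s
    rw [← lintegral_indicator measurableSet_Ioi]
    rfl
  simp_rw [e1]
  rw [lintegral_lintegral_swap (f := fun s w => {p : ℝ × ℝ | p.1 ^ 2 < p.2}.indicator (Function.uncurry g) (s, w)) hm.aemeasurable]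
  rw [← lintegral_indicator measurableSet_Ioi]
  refine lintegral_congr fun w => ?_
  by_cases hw : 0 < w
  · rw [indicator_of_mem (show w ∈ Ioi (0:ℝ) from hw), ← lintegral_indicator measurableSet_Ioo]
    refine lintegral_congr fun s => ?_
    have : s ∈ Ioo (-√w) (√w) ↔ s ^ 2 < w := by
      rw [mem_Ioo, ← abs_lt, ← Real.sqrt_sq_eq_abs, Real.sqrt_lt_sqrt_iff (sq_nonneg s)]
    by_cases h : s ^ 2 < w
    · rw [indicator_of_mem (this.2 h), indicator_of_mem (by exact h)]; rfl
    · rw [indicator_of_notMem (show (s, w) ∉ {p : ℝ × ℝ | p.1 ^ 2 < p.2} from h),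
        indicator_of_notMem (fun h' => h (this.1 h'))]
  · rw [indicator_of_notMem (by exact hw)]
    rw [← lintegral_zero (μ := (volume : Measure ℝ))]
    refine lintegral_congr fun s => ?_
    exact indicator_of_notMem (by simp only [mem_ofPred_eq]; nlinarith [sq_nonneg s]) _

lemma inner_bound (w c : ℝ) (hw : 0 < w) (hc : 0 ≤ c) :
    ∫⁻ s in Ioo (-√w) (√w), (ENNReal.ofReal √(w + 2 * c * s + c ^ 2))⁻¹ ≤ 2 := by
  have hr : 0 < √w := Real.sqrt_pos.2 hw
  have hw2 : w = √w ^ 2 := (Real.sq_sqrt hw.le).symm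
  generalize √w = r at hr hw2
  subst hw2
  have hpos : ∀ s ∈ Ioo (-r) r, 0 < r ^ 2 + 2 * c * s + c ^ 2 := by
    intro s hs
    rcases hc.eq_or_lt with rfl | hc
    · simp; positivity
    · nlinarith [mul_pos hc (show 0 < s + r by linarith [hs.1]), sq_nonneg (r - c)]
  have e : ∫⁻ s in Ioo (-r) r, (ENNReal.ofReal √(r ^ 2 + 2 * c * s + c ^ 2))⁻¹ =
      ∫⁻ s in Ioo (-r) r, ENNReal.ofReal (1 / √(r ^ 2 + 2 * c * s + c ^ 2)) := by
    refine setLIntegral_congr_fun measurableSet_Ioo fun s hs => ?_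
    rw [one_div, ENNReal.ofReal_inv_of_pos (Real.sqrt_pos.2 (hpos s hs))]
  rw [e]
  rcases hc.eq_or_lt with rfl | hc
  · simp only [mul_zero, zero_mul, add_zero, ne_eq, OfNat.ofNat_ne_zero, not_false_eq_true, zero_pow,
      lintegral_const, Measure.restrict_apply_univ, Real.volume_Ioo, Real.sqrt_sq hr.le]
    rw [← ENNReal.ofReal_mul (by positivity)]
    rw [show 1 / r * (r - -r) = 2 by field_simp; ring]
    simp
  have hcont : ContinuousOn (fun s => √(r ^ 2 + 2 * c * s + c ^ 2) / c) (Icc (-r) r) := by fun_prop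
  have hder : ∀ s ∈ Ioo (-r) r, HasDerivAt (fun s => √(r ^ 2 + 2 * c * s + c ^ 2) / c)
      (1 / √(r ^ 2 + 2 * c * s + c ^ 2)) s := by
    intro s hs
    have h1 : HasDerivAt (fun s => r ^ 2 + 2 * c * s + c ^ 2) (2 * c) s := by
      simpa using (((hasDerivAt_id s).const_mul (2 * c)).const_add (r ^ 2)).add_const (c ^ 2)
    have h2 := (h1.sqrt (hpos s hs).ne').div_const c
    have := Real.sqrt_pos.2 (hpos s hs)
    refine h2.congr_deriv ?_
    field_simp
  have hint := intervalIntegral.integrableOn_deriv_of_nonneg hcont hder (fun s _ => by positivity)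
  have hval := intervalIntegral.integral_eq_sub_of_hasDerivAt_of_le (by linarith) hcont hder
    ((intervalIntegrable_iff_integrableOn_Ioc_of_le (by linarith)).2 hint)
  rw [restrict_Ioo_eq_restrict_Ioc, ← ofReal_integral_eq_lintegral_ofReal hint
    (Filter.Eventually.of_forall fun s => by simp only [Pi.zero_apply]; positivity),
    ← intervalIntegral.integral_of_le (by linarith), hval]
  rw [show r ^ 2 + 2 * c * r + c ^ 2 = (r + c) ^ 2 by ring,
    show r ^ 2 + 2 * c * -r + c ^ 2 = (r - c) ^ 2 by ring, Real.sqrt_sq (by positivity),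
    Real.sqrt_sq_eq_abs]
  rw [show (2 : ℝ≥0∞) = ENNReal.ofReal 2 by simp]
  apply ENNReal.ofReal_le_ofReal
  rw [← sub_div, div_le_iff₀ hc]
  linarith [neg_le_abs (r - c), le_abs_self (r - c)]

lemma exists_rot (v w : E3) (h : ‖v‖ = ‖w‖) : ∃ e : E3 ≃ₗᵢ[ℝ] E3, e v = w :=
  ⟨_, Submodule.reflection_sub h⟩

lemma norm_e1 : ‖e1‖ = 1 := by simp [e1]

def pot (μ : Measure E3) (w : E3) : ℝ≥0∞ := ∫⁻ u, (ENNReal.ofReal ‖w + u‖)⁻¹ ∂μ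

lemma pot_rot (μ : Measure E3) (hμ : IsRadial μ) (e : E3 ≃ₗᵢ[ℝ] E3) (w : E3) :
    pot μ (e w) = pot μ w := by
  unfold pot
  conv_lhs => rw [← hμ e]
  rw [lintegral_map (by fun_prop) e.continuous.measurable]
  refine lintegral_congr fun u => ?_
  rw [← map_add, e.norm_map]

lemma pot_eq (μ : Measure E3) (hμ : IsRadial μ) (w : E3) :
    pot μ w = pot μ (√(‖w‖ ^ 2) • e1) := by
  obtain ⟨e, he⟩ := exists_rot (√(‖w‖ ^ 2) • e1) w (by
    rw [norm_smul, norm_e1, Real.sqrt_sq (norm_nonneg _)]; simp)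
  rw [← pot_rot μ hμ e (_ • e1), he]

lemma norm_add_smul_e1 (z : E3) (c : ℝ) : ‖z + c • e1‖ = √(‖z‖ ^ 2 + 2 * c * z 0 + c ^ 2) := by
  rw [← Real.sqrt_sq (norm_nonneg (z + c • e1)), norm_add_sq_real, norm_smul, norm_e1,
    inner_smul_right]
  have : inner ℝ z e1 = z 0 := by simp [e1, EuclideanSpace.inner_single_right]
  rw [this, mul_one, Real.norm_eq_abs, sq_abs, mul_assoc]

lemma ball_avg (u : E3) (φ : ℝ → ℝ≥0∞) (hφ : Measurable φ) :
    ∫⁻ z : E3, φ (‖z‖ ^ 2) * (ENNReal.ofReal ‖z + u‖)⁻¹ ≤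
      ENNReal.ofReal π * ∫⁻ w in Ioi (0:ℝ), φ w * 2 := by
  obtain ⟨e, he⟩ := exists_rot (‖u‖ • e1) u (by
    rw [norm_smul, norm_e1]; simp)
  have hm : Measurable (fun z : E3 => φ (‖z‖ ^ 2) * (ENNReal.ofReal ‖z + u‖)⁻¹) := by fun_prop
  rw [← e.measurePreserving.lintegral_comp hm]
  have e2 : ∀ z : E3, φ (‖e z‖ ^ 2) * (ENNReal.ofReal ‖e z + u‖)⁻¹ =
      (fun s w : ℝ => φ w * (ENNReal.ofReal √(w + 2 * ‖u‖ * s + ‖u‖ ^ 2))⁻¹) (z 0) (‖z‖ ^ 2) := by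
    intro z
    have : e z + u = e (z + ‖u‖ • e1) := by rw [map_add, he]
    rw [this, e.norm_map, e.norm_map, norm_add_smul_e1]
  simp_rw [e2]
  rw [lint_space' (fun s w : ℝ => φ w * (ENNReal.ofReal √(w + 2 * ‖u‖ * s + ‖u‖ ^ 2))⁻¹)
    (by unfold Function.uncurry; fun_prop)]
  refine mul_le_mul_right ?_ _
  refine setLIntegral_mono' measurableSet_Ioi fun w hw => ?_
  rw [lintegral_const_mul _ (by fun_prop)]
  gcongr
  exact inner_bound w _ hw (norm_nonneg _)

lemma measurable_pot (μ : Measure E3) [SFinite μ] : Measurable (pot μ) := by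
  unfold pot
  exact Measurable.lintegral_prod_right' (f := fun p : E3 × E3 => (ENNReal.ofReal ‖p.1 + p.2‖)⁻¹)
    (by fun_prop)

lemma pot_ae (μ : Measure E3) [IsProbabilityMeasure μ] (hμ : IsRadial μ) :
    ∀ᵐ w ∂(volume.restrict (Ioi (0:ℝ))), pot μ (√w • e1) * ENNReal.ofReal (2 * √w) ≤ 2 := by
  have mp := measurable_pot μ
  have mh : Measurable (fun w : ℝ => pot μ (√w • e1)) := mp.comp (by fun_prop)
  refine ae_le_of_forall_setLIntegral_le_of_sigmaFinite
    (f := fun w => pot μ (√w • e1) * ENNReal.ofReal (2 * √w)) (g := fun _ => 2) (by fun_prop) ?_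
  intro A hA _
  set φ : ℝ → ℝ≥0∞ := A.indicator 1 with hφdef
  have hφ : Measurable φ := measurable_one.indicator hA
  have ind : ∀ f : ℝ → ℝ≥0∞, ∫⁻ w in A, f w ∂(volume.restrict (Ioi (0:ℝ))) =
      ∫⁻ w in Ioi (0:ℝ), φ w * f w := by
    intro f
    rw [← lintegral_indicator hA]
    refine lintegral_congr fun w => ?_
    by_cases h : w ∈ A <;> simp [hφdef, h]
  rw [ind, ind]
  have h1 : ∫⁻ z : E3, φ (‖z‖ ^ 2) * pot μ z ≤
      ENNReal.ofReal π * ∫⁻ w in Ioi (0:ℝ), φ w * 2 := by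
    have : ∀ z : E3, φ (‖z‖ ^ 2) * pot μ z =
        ∫⁻ u, φ (‖z‖ ^ 2) * (ENNReal.ofReal ‖z + u‖)⁻¹ ∂μ := by
      intro z
      rw [pot, lintegral_const_mul _ (by fun_prop)]
    simp_rw [this]
    rw [lintegral_lintegral_swap (by unfold Function.uncurry; fun_prop)]
    calc _ ≤ ∫⁻ _ : E3, (ENNReal.ofReal π * ∫⁻ w in Ioi (0:ℝ), φ w * 2) ∂μ :=
          lintegral_mono fun u => ball_avg u φ hφ
      _ = _ := by simp
  have h2 : ∫⁻ z : E3, φ (‖z‖ ^ 2) * pot μ z = ENNReal.ofReal π *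
      ∫⁻ w in Ioi (0:ℝ), φ w * (pot μ (√w • e1) * ENNReal.ofReal (2 * √w)) := by
    have : ∀ z : E3, φ (‖z‖ ^ 2) * pot μ z =
      (fun _ w : ℝ => φ w * pot μ (√w • e1)) (z 0) (‖z‖ ^ 2) := by
      intro z
      rw [pot_eq μ hμ z]
    simp_rw [this]
    rw [lint_space' (fun _ w : ℝ => φ w * pot μ (√w • e1)) (by unfold Function.uncurry; fun_prop)]
    congr 1
    refine lintegral_congr fun w => ?_
    simp only [lintegral_const, Measure.restrict_apply_univ, Real.volume_Ioo]
    rw [show √w - -√w = 2 * √w by ring, mul_assoc]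
  rw [h2] at h1
  exact (ENNReal.mul_le_mul_iff_right (by simp [Real.pi_pos]) ENNReal.ofReal_ne_top).1 h1

lemma newton (μ : Measure E3) [IsProbabilityMeasure μ] (hμ : IsRadial μ) (w : E3) :
    pot μ w ≤ (ENNReal.ofReal ‖w‖)⁻¹ := by
  rcases eq_or_ne w 0 with rfl | hw
  · simp
  have hw' : 0 < ‖w‖ := norm_pos_iff.2 hw
  have hae := pot_ae μ hμ
  rw [ae_restrict_iff' measurableSet_Ioi] at hae
  have hd : Dense {t : ℝ | t ∈ Ioi (0:ℝ) → pot μ (√t • e1) * ENNReal.ofReal (2 * √t) ≤ 2} :=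
    Measure.dense_of_ae hae
  obtain ⟨t, ht, htl⟩ := mem_closure_iff_seq_limit.1 (hd (‖w‖ ^ 2))
  have hpos : ∀ᶠ n in atTop, 0 < t n := htl.eventually (lt_mem_nhds (by positivity))
  have hb : ∀ᶠ n in atTop, pot μ (√(t n) • e1) ≤ (ENNReal.ofReal √(t n))⁻¹ := by
    filter_upwards [hpos] with n hn
    have h := ht n hn
    have hs : 0 < √(t n) := Real.sqrt_pos.2 hn
    rw [ENNReal.ofReal_mul zero_le_two, ENNReal.ofReal_ofNat, mul_comm, mul_assoc] at h
    have h' := (ENNReal.mul_le_mul_iff_right (a := 2) (by simp) (by simp)).1 (h.trans_eq (mul_one _).symm)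
    rw [← one_div, ENNReal.le_div_iff_mul_le (by simp [hs]) (by simp), mul_comm]
    exact h'
  have hlim : Tendsto (fun n => √(t n)) atTop (𝓝 √(‖w‖ ^ 2)) :=
    (Real.continuous_sqrt.tendsto _).comp htl
  rw [pot_eq μ hμ w]
  have hR : Tendsto (fun n => (ENNReal.ofReal √(t n))⁻¹) atTop (𝓝 (ENNReal.ofReal ‖w‖)⁻¹) := by
    rw [Real.sqrt_sq hw'.le] at hlim
    exact ((continuous_inv (G := ℝ≥0∞)).comp ENNReal.continuous_ofReal).continuousAt.tendsto.comp hlim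
  calc pot μ (√(‖w‖ ^ 2) • e1)
      = ∫⁻ u, liminf (fun n => (ENNReal.ofReal ‖√(t n) • e1 + u‖)⁻¹) atTop ∂μ := by
        refine lintegral_congr fun u => ?_
        have hc : Continuous fun r : ℝ => (ENNReal.ofReal ‖r • e1 + u‖)⁻¹ :=
          (continuous_inv (G := ℝ≥0∞)).comp (ENNReal.continuous_ofReal.comp (by fun_prop))
        exact ((hc.tendsto _).comp hlim).liminf_eq.symm
    _ ≤ liminf (fun n => pot μ (√(t n) • e1)) atTop := lintegral_liminf_le fun n => by fun_prop
    _ ≤ liminf (fun n => (ENNReal.ofReal √(t n))⁻¹) atTop := liminf_le_liminf hb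
    _ = _ := hR.liminf_eq

def FF (x y : E3) : ℝ≥0∞ :=
  ∫⁻ t in Ioi (0:ℝ), ENNReal.ofReal ((t ^ 5)⁻¹) * volume (ball x t ∩ ball y t)

lemma vol_scale (x a b : E3) (r t : ℝ) (hr : 0 < r) (e : E3 ≃ₗᵢ[ℝ] E3) :
    volume (ball (x + r • e a) (r * t) ∩ ball (x + r • e b) (r * t)) =
      ENNReal.ofReal (r ^ 3) * volume (ball a t ∩ ball b t) := by
  set S := ball (x + r • e a) (r * t) ∩ ball (x + r • e b) (r * t) with hS
  have h0 : Set.preimage e (Set.preimage (fun z : E3 => r • z) (Set.preimage (fun z => x + z) S)) = ball a t ∩ ball b t := by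
    ext z
    have : ∀ a : E3, dist (x + r • e z) (x + r • e a) < r * t ↔ dist z a < t := by
      intro a
      rw [dist_add_left, dist_smul₀, e.dist_map, Real.norm_eq_abs, abs_of_pos hr]
      exact mul_lt_mul_iff_right₀ hr
    exact and_congr (this a) (this b)
  have hSm : MeasurableSet S := measurableSet_ball.inter measurableSet_ball
  have hS1 : MeasurableSet (Set.preimage (fun z => x + z) S) := by
    exact (measurable_const_add x) hSm
  have hS2 : MeasurableSet (Set.preimage (fun z : E3 => r • z) (Set.preimage (fun z => x + z) S)) :=
    (measurable_const_smul r) hS1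
  rw [← h0, e.measurePreserving.measure_preimage hS2.nullMeasurableSet,
    Measure.addHaar_preimage_smul _ hr.ne', measure_preimage_add, ← mul_assoc,
    ← ENNReal.ofReal_mul (by positivity)]
  have : r ^ 3 * |(r ^ Module.finrank ℝ E3)⁻¹| = 1 := by
    rw [abs_of_pos (by positivity)]
    simp
    field_simp
  rw [this]
  simp

lemma FF_scale (x a b : E3) (r : ℝ) (hr : 0 < r) (e : E3 ≃ₗᵢ[ℝ] E3) :
    FF (x + r • e a) (x + r • e b) = (ENNReal.ofReal r)⁻¹ * FF a b := by
  unfold FF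
  have him : Set.image (fun t : ℝ => r * t) (Ioi 0) = Ioi 0 := by
    rw [image_mul_left_Ioi hr, mul_zero]
  conv_lhs => rw [← him]
  rw [lintegral_image_eq_lintegral_abs_deriv_mul (f' := fun _ => r) measurableSet_Ioi
    (fun t _ => by simpa using ((hasDerivAt_id t).const_mul r).hasDerivWithinAt)
    (fun s _ t _ h => mul_left_cancel₀ hr.ne' h)]
  rw [← lintegral_const_mul' _ _ (by simp [hr])]
  refine setLIntegral_congr_fun measurableSet_Ioi fun t ht => ?_
  have ht' : (0:ℝ) < t := ht
  rw [vol_scale x a b r t hr e, ← mul_assoc, ← mul_assoc, ← mul_assoc, ← ENNReal.ofReal_inv_of_pos hr,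
    ← ENNReal.ofReal_mul (by positivity), ← ENNReal.ofReal_mul (by positivity),
    ← ENNReal.ofReal_mul (by positivity), abs_of_pos hr]
  congr 2
  field_simp

lemma FF_ne_zero (a b : E3) : FF a b ≠ 0 := by
  unfold FF
  have hm : Measurable fun t : ℝ => volume (ball a t ∩ ball b t) := by
    refine Monotone.measurable fun s t hst => ?_
    exact measure_mono (inter_subset_inter (ball_subset_ball hst) (ball_subset_ball hst))
  intro h
  rw [lintegral_eq_zero_iff (by fun_prop)] at h
  rw [Filter.EventuallyEq, ae_restrict_iff' measurableSet_Ioi] at h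
  have h2 : volume (Ioi (dist a b)) = 0 := by
    refine measure_mono_null (fun t ht => ?_) h
    have ht' : dist a b < t := ht
    have ht0 : 0 < t := dist_nonneg.trans_lt ht'
    have hp : volume (ball a t ∩ ball b t) ≠ 0 :=
      ((isOpen_ball.inter isOpen_ball).measure_pos volume ⟨a, by simp [ht0, ht']⟩).ne'
    intro hc
    have := hc ht0
    simp only [Pi.zero_apply, mul_eq_zero, hp, or_false, ENNReal.ofReal_eq_zero] at this
    have : 0 < (t ^ 5)⁻¹ := by positivity
    linarith
  simp at h2

lemma FF_ne_top : FF 0 e1 ≠ ⊤ := by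
  unfold FF
  have hle : ∫⁻ t in Ioi (0:ℝ), ENNReal.ofReal ((t ^ 5)⁻¹) * volume (ball (0:E3) t ∩ ball e1 t) ≤
      ∫⁻ t in Ioi (1/2:ℝ), ENNReal.ofReal (t ^ (-2:ℝ)) * volume (ball (0:E3) 1) := by
    rw [← lintegral_indicator measurableSet_Ioi, ← lintegral_indicator measurableSet_Ioi]
    refine lintegral_mono fun t => ?_
    by_cases h : 1 / 2 < t
    · have h0 : 0 < t := by linarith
      rw [indicator_of_mem (show t ∈ Ioi (0:ℝ) from h0), indicator_of_mem (show t ∈ Ioi (1/2:ℝ) from h)]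
      calc _ ≤ ENNReal.ofReal ((t ^ 5)⁻¹) * volume (ball (0:E3) t) := by
            gcongr; exact inter_subset_left
        _ = _ := by
            rw [Measure.addHaar_ball_of_pos _ _ h0, ← mul_assoc, ← ENNReal.ofReal_mul (by positivity)]
            congr 2
            rw [Real.rpow_neg h0.le]
            simp
            field_simp
    · rw [indicator_of_notMem (show t ∉ Ioi (1/2:ℝ) from h)]
      have : ball (0:E3) t ∩ ball e1 t = ∅ := by
        rw [← disjoint_iff_inter_eq_empty]
        apply ball_disjoint_ball
        rw [dist_zero_left, norm_e1]; linarith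
      by_cases h0 : t ∈ Ioi (0:ℝ)
      · rw [indicator_of_mem h0, this]; simp
      · rw [indicator_of_notMem h0]
  refine ne_top_of_le_ne_top ?_ hle
  rw [lintegral_mul_const' _ _ measure_ball_lt_top.ne]
  refine ENNReal.mul_ne_top ?_ measure_ball_lt_top.ne
  exact ((integrableOn_Ioi_rpow_of_lt (by norm_num) (by norm_num)).lintegral_lt_top).ne

lemma FF_eq (x y : E3) : FF x y = FF 0 e1 * coul x y := by
  rcases eq_or_ne x y with rfl | hxy
  · have h1 : FF x x = FF 0 0 := by
      simpa using FF_scale x 0 0 1 one_pos (LinearIsometryEquiv.refl ℝ E3)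
    have h2 : FF 0 0 = 2⁻¹ * FF 0 0 := by
      simpa using FF_scale 0 0 0 2 two_pos (LinearIsometryEquiv.refl ℝ E3)
    have h3 : FF 0 0 = ⊤ := by
      by_contra hne
      have := ENNReal.mul_inv_cancel (FF_ne_zero 0 0) hne
      have h4 : (1:ℝ≥0∞) = 2⁻¹ := by
        calc (1:ℝ≥0∞) = FF 0 0 * (FF 0 0)⁻¹ := this.symm
          _ = 2⁻¹ * (FF 0 0 * (FF 0 0)⁻¹) := by rw [← mul_assoc, ← h2]
          _ = 2⁻¹ := by rw [this, mul_one]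
      have := ENNReal.one_half_lt_one
      rw [← h4] at this
      exact lt_irrefl _ this
    simp [coul, h1, h3, FF_ne_zero]
  · have hr : 0 < ‖x - y‖ := norm_pos_iff.2 (sub_ne_zero.2 hxy)
    obtain ⟨e, he⟩ := exists_rot e1 (‖x - y‖⁻¹ • (y - x)) (by
      rw [norm_e1, norm_smul, norm_inv, norm_norm, norm_sub_rev y x, inv_mul_cancel₀ hr.ne'])
    have := FF_scale x 0 e1 ‖x - y‖ hr e
    rw [he, smul_smul, mul_inv_cancel₀ hr.ne', one_smul, map_zero, smul_zero, add_zero,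
      add_sub_cancel] at this
    rw [this, coul, mul_comm]

def mm : Measure (ℝ × E3) :=
  ((volume.restrict (Ioi (0:ℝ))).withDensity fun t => ENNReal.ofReal ((t ^ 5)⁻¹)).prod volume

instance : SFinite mm := by unfold mm; infer_instance

def PP (p : ℝ × E3) (x : E3) : ℝ≥0∞ :=
  {q : (ℝ × E3) × E3 | dist q.2 q.1.2 < q.1.1}.indicator 1 (p, x)

lemma measurable_PP : Measurable (Function.uncurry PP) := by
  have : MeasurableSet {q : (ℝ × E3) × E3 | dist q.2 q.1.2 < q.1.1} :=
    measurableSet_lt (by fun_prop) (by fun_prop)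
  exact measurable_one.indicator this

@[fun_prop]
lemma measurable_PP_comp {α : Type*} [MeasurableSpace α] {f : α → ℝ × E3} {g : α → E3}
    (hf : Measurable f) (hg : Measurable g) : Measurable (fun a => PP (f a) (g a)) := by
  have h : Measurable (fun a => (f a, g a)) := hf.prodMk hg
  have h2 : Measurable (Function.uncurry PP ∘ fun a => (f a, g a)) := Measurable.comp measurable_PP h
  exact h2

lemma FF_PP (x y : E3) : FF x y = ∫⁻ p, PP p x * PP p y ∂mm := by
  have hm : Measurable fun p : ℝ × E3 => PP p x * PP p y := by fun_prop
  have hm' : Measurable fun t : ℝ => ∫⁻ z, PP (t, z) x * PP (t, z) y :=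
    hm.lintegral_prod_right'
  rw [mm, lintegral_prod _ hm.aemeasurable, lintegral_withDensity_eq_lintegral_mul _ (by fun_prop) hm']
  unfold FF
  refine lintegral_congr fun t => ?_
  simp only [Pi.mul_apply]
  congr 1
  rw [← lintegral_indicator_one (measurableSet_ball.inter measurableSet_ball)]
  refine lintegral_congr fun z => ?_
  by_cases h1 : dist x z < t <;> by_cases h2 : dist y z < t <;>
    simp [PP, indicator, h1, h2, dist_comm z]

def BB (ν₁ ν₂ : Measure E3) : ℝ≥0∞ := ∫⁻ x, ∫⁻ y, coul x y ∂ν₂ ∂ν₁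

@[fun_prop]
lemma measurable_coul {α : Type*} [MeasurableSpace α] {f g : α → E3}
    (hf : Measurable f) (hg : Measurable g) : Measurable fun a => coul (f a) (g a) := by
  unfold coul; fun_prop

lemma BB_repr (σ η : Measure E3) [SFinite σ] [SFinite η] :
    FF 0 e1 * BB σ η = ∫⁻ p, (∫⁻ x, PP p x ∂σ) * (∫⁻ y, PP p y ∂η) ∂mm := by
  have h1 : FF 0 e1 * BB σ η = ∫⁻ x, ∫⁻ y, FF x y ∂η ∂σ := by
    unfold BB
    rw [← lintegral_const_mul' _ _ FF_ne_top]
    refine lintegral_congr fun x => ?_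
    rw [← lintegral_const_mul' _ _ FF_ne_top]
    refine lintegral_congr fun y => (FF_eq x y).symm
  have mη : Measurable fun p => ∫⁻ y, PP p y ∂η :=
    Measurable.lintegral_prod_right' (f := fun q : (ℝ × E3) × E3 => PP q.1 q.2) (by fun_prop)
  rw [h1]
  have h2 : ∀ x, ∫⁻ y, FF x y ∂η = ∫⁻ p, PP p x * (∫⁻ y, PP p y ∂η) ∂mm := by
    intro x
    simp_rw [FF_PP]
    rw [lintegral_lintegral_swap (by unfold Function.uncurry; fun_prop)]
    refine lintegral_congr fun p => ?_
    rw [lintegral_const_mul _ (by fun_prop)]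
  simp_rw [h2]
  rw [lintegral_lintegral_swap (by unfold Function.uncurry; fun_prop)]
  refine lintegral_congr fun p => ?_
  rw [lintegral_mul_const _ (by fun_prop)]

lemma amgm (a b : ℝ≥0∞) : 2 * (a * b) ≤ a * a + b * b := by
  wlog h : a ≤ b generalizing a b
  · have := this b a (le_of_not_ge h)
    rwa [mul_comm b a, add_comm] at this
  obtain ⟨c, rfl⟩ := exists_add_of_le h
  calc 2 * (a * (a + c)) ≤ 2 * (a * (a + c)) + c * c := le_self_add
    _ = _ := by ring

lemma BB_cs (σ η : Measure E3) [SFinite σ] [SFinite η] : 2 * BB σ η ≤ BB σ σ + BB η η := by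
  have mσ : Measurable fun p => ∫⁻ y, PP p y ∂σ :=
    Measurable.lintegral_prod_right' (f := fun q : (ℝ × E3) × E3 => PP q.1 q.2) (by fun_prop)
  refine (ENNReal.mul_le_mul_iff_right (FF_ne_zero 0 e1) FF_ne_top).1 ?_
  rw [mul_left_comm, mul_add, BB_repr, BB_repr, BB_repr, ← lintegral_const_mul' _ _ (by simp),
    ← lintegral_add_left (by fun_prop)]
  exact lintegral_mono fun p => amgm _ _

lemma newton' (μ : Measure E3) [IsProbabilityMeasure μ] (hμ : IsRadial μ) (w : E3) (c : ℝ) :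
    ∫⁻ u, (ENNReal.ofReal ‖w + c • u‖)⁻¹ ∂μ ≤ (ENNReal.ofReal ‖w‖)⁻¹ := by
  have hc : Measurable fun u : E3 => c • u := by fun_prop
  have hp : IsProbabilityMeasure (μ.map fun u => c • u) := Measure.isProbabilityMeasure_map hc.aemeasurable
  have hr : IsRadial (μ.map fun u => c • u) := by
    intro e
    have he : Measurable e := e.continuous.measurable
    rw [Measure.map_map he hc]
    conv_rhs => rw [← hμ e]
    rw [Measure.map_map hc he]
    congr 1
    ext1 u
    simp
  have := newton _ hr w
  rwa [pot, lintegral_map (by fun_prop) hc] at this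

lemma BB_map (μ : Measure E3) [SFinite μ] (x y : E3) (a b : ℝ) :
    BB (μ.map fun u => x + a • u) (μ.map fun u => y + b • u) =
      ∫⁻ u, ∫⁻ v, coul (x + a • u) (y + b • v) ∂μ ∂μ := by
  unfold BB
  have : ∀ z, ∫⁻ y, coul z y ∂(μ.map fun u => y + b • u) = ∫⁻ v, coul z (y + b • v) ∂μ :=
    fun z => lintegral_map (by fun_prop) (by fun_prop)
  simp_rw [this]
  rw [lintegral_map _ (by fun_prop)]
  exact Measurable.lintegral_prod_right' (f := fun q : E3 × E3 => coul q.1 (y + b • q.2)) (by fun_prop)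

lemma BB_newton (μ : Measure E3) [IsProbabilityMeasure μ] (hμ : IsRadial μ) (x y : E3) (a b : ℝ) :
    BB (μ.map fun u => x + a • u) (μ.map fun u => y + b • u) ≤ coul x y := by
  rw [BB_map]
  calc _ ≤ ∫⁻ u, (ENNReal.ofReal ‖(x - y) + a • u‖)⁻¹ ∂μ := by
        refine lintegral_mono fun u => ?_
        refine le_trans (le_of_eq ?_) (newton' μ hμ ((x - y) + a • u) (-b))
        refine lintegral_congr fun v => ?_
        rw [coul]
        congr 3
        rw [neg_smul]; abel
    _ ≤ _ := newton' μ hμ (x - y) a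

lemma BB_self (μ : Measure E3) [SFinite μ] (x : E3) (r : ℝ) (hr : 0 < r) :
    BB (μ.map fun u => x + r • u) (μ.map fun u => x + r • u) = ENNReal.ofReal r⁻¹ * BB μ μ := by
  rw [BB_map, BB, ← lintegral_const_mul' _ _ (by simp)]
  refine lintegral_congr fun u => ?_
  rw [← lintegral_const_mul' _ _ (by simp)]
  refine lintegral_congr fun v => ?_
  rw [coul, coul, add_sub_add_left_eq_sub, ← smul_sub, norm_smul, Real.norm_eq_abs, abs_of_pos hr,
    ENNReal.ofReal_mul hr.le, ENNReal.ofReal_inv_of_pos hr, ENNReal.mul_inv (by simp [hr]) (by simp)]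

lemma BB_sum_left {ι : Type*} (s : Finset ι) (m : ι → Measure E3) (η : Measure E3) :
    BB (∑ i ∈ s, m i) η = ∑ i ∈ s, BB (m i) η := by
  unfold BB; rw [lintegral_finsetSum_measure]

lemma BB_sum_right {ι : Type*} (s : Finset ι) (m : ι → Measure E3) [∀ i, SFinite (m i)] (η : Measure E3) :
    BB η (∑ i ∈ s, m i) = ∑ i ∈ s, BB η (m i) := by
  unfold BB
  simp_rw [lintegral_finsetSum_measure]
  rw [lintegral_finsetSum]
  intro i _
  exact Measurable.lintegral_prod_right' (f := fun q : E3 × E3 => coul q.1 q.2) (by fun_prop)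

/-- **Pointwise Onsager-type bound**: for any points `x₁,…,x_N` with `ρ(x_j) > 0`,
`Σ_{j<k} |x_j-x_k|⁻¹ ≥ -D(η,η) + 2 Σ_j D(μ_{x_j}, η) - D(μ,μ) Σ_j ρ(x_j)^{1/3}`.
The left side is interpreted in `ℝ≥0∞` (it equals `∞` if two points coincide). -/
theorem onsager_pointwise_bound (ρ : E3 → ℝ) (hρm : Measurable ρ)
    (μ : Measure E3) [IsProbabilityMeasure μ] (hμrad : IsRadial μ) (hDμ : DD μ μ < ⊤)
    (η : Measure E3) [IsFiniteMeasure η] (hDη : DD η η < ⊤)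
    (N : ℕ) (x : Fin N → E3) (hx : ∀ j, 0 < ρ (x j)) :
    ENNReal.ofReal (-Dr η η + 2 * ∑ j : Fin N, Dr (smear μ ρ (x j)) η
        - Dr μ μ * ∑ j : Fin N, ρ (x j) ^ ((1:ℝ)/3)) ≤
      ∑ j : Fin N, ∑ k : Fin N, if j < k then coul (x j) (x k) else 0 := by
  set S := ∑ j : Fin N, ∑ k : Fin N, if j < k then coul (x j) (x k) else 0 with hS
  have hDB : ∀ a b : Measure E3, DD a b = 2⁻¹ * BB a b := fun _ _ => rfl
  have hprob : ∀ j, IsProbabilityMeasure (smear μ ρ (x j)) := fun j =>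
    Measure.isProbabilityMeasure_map (by fun_prop)
  have hself : ∀ j, BB (smear μ ρ (x j)) (smear μ ρ (x j)) =
      ENNReal.ofReal (ρ (x j) ^ ((1:ℝ)/3)) * BB μ μ := by
    intro j
    unfold smear
    rw [BB_self μ (x j) _ (Real.rpow_pos_of_pos (hx j) _), ← Real.rpow_neg (hx j).le]
    congr 3
    norm_num
  have hoff : ∀ j k, BB (smear μ ρ (x j)) (smear μ ρ (x k)) ≤ coul (x j) (x k) := fun j k =>
    BB_newton μ hμrad _ _ _ _
  have hsym : ∀ a b : E3, coul a b = coul b a := fun a b => by rw [coul, coul, norm_sub_rev]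
  have hcs := BB_cs (∑ j, smear μ ρ (x j)) η
  rw [BB_sum_left, BB_sum_left] at hcs
  simp_rw [BB_sum_right] at hcs
  have hdd : ∑ j, ∑ k, BB (smear μ ρ (x j)) (smear μ ρ (x k)) ≤
      BB μ μ * ∑ j, ENNReal.ofReal (ρ (x j) ^ ((1:ℝ)/3)) + 2 * S := by
    calc _ ≤ ∑ j, ∑ k, ((if j = k then ENNReal.ofReal (ρ (x j) ^ ((1:ℝ)/3)) * BB μ μ else 0) +
            ((if j < k then coul (x j) (x k) else 0) + (if k < j then coul (x k) (x j) else 0))) := by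
          refine Finset.sum_le_sum fun j _ => Finset.sum_le_sum fun k _ => ?_
          rcases lt_trichotomy j k with h | h | h
          · simp [h, h.ne, h.not_gt, hoff]
          · subst h; simp [hself]
          · simp [h, h.ne', h.not_gt, hoff, hsym (x k)]
      _ = _ := by
          simp_rw [Finset.sum_add_distrib]
          rw [Finset.sum_comm (f := fun j k : Fin N => if k < j then coul (x k) (x j) else 0), ← hS,
            two_mul]
          simp [Finset.mul_sum, mul_comm]
  have main : 2 * ∑ j, DD (smear μ ρ (x j)) η ≤
      DD μ μ * ∑ j, ENNReal.ofReal (ρ (x j) ^ ((1:ℝ)/3)) + S + DD η η := by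
    simp_rw [hDB]
    rw [← Finset.mul_sum]
    have h22 : (2:ℝ≥0∞)⁻¹ * 2 = 1 := ENNReal.inv_mul_cancel (by simp) (by simp)
    calc 2 * (2⁻¹ * ∑ j, BB (smear μ ρ (x j)) η) = 2⁻¹ * (2 * ∑ j, BB (smear μ ρ (x j)) η) := by
          ring
      _ ≤ 2⁻¹ * (BB μ μ * ∑ j, ENNReal.ofReal (ρ (x j) ^ ((1:ℝ)/3)) + 2 * S + BB η η) := by
          gcongr
          refine hcs.trans ?_
          gcongr
      _ = 2⁻¹ * BB μ μ * ∑ j, ENNReal.ofReal (ρ (x j) ^ ((1:ℝ)/3)) + (2⁻¹ * 2) * S + 2⁻¹ * BB η η := by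
          ring
      _ = _ := by rw [h22, one_mul]
  rcases eq_or_ne S ⊤ with hT | hT
  · rw [hT]; exact le_top
  have f1 : ∑ j, ENNReal.ofReal (ρ (x j) ^ ((1:ℝ)/3)) ≠ ⊤ := by simp [ENNReal.sum_eq_top]
  have f2 : DD μ μ * ∑ j, ENNReal.ofReal (ρ (x j) ^ ((1:ℝ)/3)) ≠ ⊤ := ENNReal.mul_ne_top hDμ.ne f1
  have f3 := ENNReal.add_ne_top.2 ⟨f2, hT⟩
  have fR := ENNReal.add_ne_top.2 ⟨f3, hDη.ne⟩
  have fL := ne_top_of_le_ne_top fR main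
  have f4 : ∀ j ∈ Finset.univ, DD (smear μ ρ (x j)) η ≠ ⊤ := by
    have : ∑ j, DD (smear μ ρ (x j)) η ≠ ⊤ := by
      intro h
      rw [h] at fL
      simp at fL
    intro j hj h
    exact this (ENNReal.sum_eq_top.2 ⟨j, hj, h⟩)
  have hreal := ENNReal.toReal_mono fR main
  rw [ENNReal.toReal_add f3 hDη.ne, ENNReal.toReal_add f2 hT, ENNReal.toReal_mul, ENNReal.toReal_mul,
    ENNReal.toReal_sum f4, ENNReal.toReal_sum (by simp)] at hreal
  have h5 : ∀ j, (ENNReal.ofReal (ρ (x j) ^ ((1:ℝ)/3))).toReal = ρ (x j) ^ ((1:ℝ)/3) := fun j =>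
    ENNReal.toReal_ofReal (Real.rpow_nonneg (hx j).le _)
  simp_rw [h5] at hreal
  rw [ENNReal.toReal_ofNat] at hreal
  apply ENNReal.ofReal_le_of_le_toReal
  unfold Dr
  linarith
end
end

section
/- The function g_Θ(a) := max_{0≤b≤a} { Θ(a,b) − Θ(b,b)₊/2 } is the unique nonnegative function on [0,1] satisfying the fixed point equation f(a) = max_{0≤b≤a} { Θ(a,b) − f(b) } for all a ∈ [0,1]. Moreover, any nonnegative solution f of this equation also satisfies f(a) = max_{0≤b≤1} { Θ(a,b) − f(b) } for all a ∈ [0,1]. -/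
open MeasureTheory ENNReal Set Metric Filter Real Topology

noncomputable section

/-- `Θ(a,b) = a³b³(1-a-b)`. -/
def Theta (a b : ℝ) : ℝ := a ^ 3 * b ^ 3 * (1 - a - b)

/-- `g_Θ(a) = max_{0 ≤ b ≤ a} { Θ(a,b) - Θ(b,b)₊/2 }`. -/
def gTheta (a : ℝ) : ℝ := sSup ((fun b => Theta a b - max (Theta b b) 0 / 2) '' Icc 0 a)

lemma aux_p_mono {a b : ℝ} (hb : 0 ≤ b) (hba : b ≤ a) (ha : a ≤ 3/8) :
    b^3*(1-2*b) ≤ a^3*(1-2*a) := by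
  have h0 : 0 ≤ a := hb.trans hba
  have key : a^3*(1-2*a) - b^3*(1-2*b)
      = (a-b)*((a^2+a*b+b^2) - 2*(a^3+a^2*b+a*b^2+b^3)) := by ring
  have h1 : 0 ≤ (a^2+a*b+b^2) - 2*(a^3+a^2*b+a*b^2+b^3) := by
    have e1 : 0 ≤ (3-8*a)*(a^2+a*b+b^2) := mul_nonneg (by linarith) (by positivity)
    have e2 : b^3 ≤ a^3 := by gcongr
    have e3 : b*b^2 ≤ a*b^2 := by gcongr
    have e4 : a^2*b ≤ a^2*a := by gcongr
    have e5 : 0 ≤ a^2*b := by positivity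
    have e6 : 0 ≤ a*b^2 := by positivity
    nlinarith
  have := mul_nonneg (sub_nonneg.2 hba) h1
  linarith

lemma aux_p_anti {a b : ℝ} (hb : 3/8 ≤ b) (hba : b ≤ a) :
    a^3*(1-2*a) ≤ b^3*(1-2*b) := by
  have h0 : 0 ≤ b := by linarith
  have h0' : 0 ≤ a := by linarith
  have key : b^3*(1-2*b) - a^3*(1-2*a)
      = (a-b)*(2*(a^3+a^2*b+a*b^2+b^3) - (a^2+a*b+b^2)) := by ring
  have h1 : 0 ≤ 2*(a^3+a^2*b+a*b^2+b^3) - (a^2+a*b+b^2) := by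
    have e1 : 0 ≤ (8*b-3)*(a^2+a*b+b^2) := mul_nonneg (by linarith) (by positivity)
    have e2 : b^3 ≤ a^3 := by gcongr
    have e3 : a*b^2 ≤ a*a^2 := by gcongr
    have e4 : a^2*b ≤ a^2*a := by gcongr
    nlinarith
  have := mul_nonneg (sub_nonneg.2 hba) h1
  linarith

lemma aux_ident (a b : ℝ) : Theta a b - Theta b b / 2
    = Theta a a / 2 - (a^3-b^3)*(a^3*(1-2*a) - b^3*(1-2*b))/2 := by
  unfold Theta; ring

lemma aux_diag_nonneg {b : ℝ} (hb : b ≤ 1/2) : max (Theta b b) 0 = Theta b b := by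
  apply max_eq_left
  have : Theta b b = (b^3)^2*(1-2*b) := by unfold Theta; ring
  rw [this]
  exact mul_nonneg (sq_nonneg _) (by linarith)

lemma aux_small {a b : ℝ} (hb : 0 ≤ b) (hba : b ≤ a) (ha : a ≤ 3/8) :
    Theta a b - max (Theta b b) 0 / 2 ≤ max (Theta a a) 0 / 2 := by
  rw [aux_diag_nonneg (by linarith), aux_diag_nonneg (by linarith), aux_ident]
  have h1 : b^3 ≤ a^3 := by gcongr
  have := mul_nonneg (sub_nonneg.2 h1) (sub_nonneg.2 (aux_p_mono hb hba ha))
  linarith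

lemma aux_large_half {a b : ℝ} (hb : 3/8 ≤ b) (hba : b ≤ a) (hb2 : b ≤ 1/2) :
    Theta a b - max (Theta b b) 0 / 2
      ≤ Theta a (3/8) - max (Theta (3/8) (3/8)) 0 / 2 := by
  rw [aux_diag_nonneg (by linarith), aux_diag_nonneg (by norm_num), aux_ident,
    aux_ident a (3/8)]
  have h1 : b^3 ≤ a^3 := by gcongr
  have h2 : (3/8:ℝ)^3 ≤ b^3 := by gcongr
  have h3 := aux_p_anti hb hba
  have h4 := aux_p_anti (le_refl (3/8:ℝ)) hb
  have := mul_le_mul (sub_le_sub_left h2 (a^3)) (sub_le_sub_right h4 (a^3*(1-2*a)))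
    (sub_nonneg.2 h3) (by linarith)
  linarith

lemma aux_large {a b : ℝ} (hb : 3/8 ≤ b) (hba : b ≤ a) :
    Theta a b - max (Theta b b) 0 / 2
      ≤ Theta a (3/8) - max (Theta (3/8) (3/8)) 0 / 2 := by
  rcases le_total b (1/2) with h | h
  · exact aux_large_half hb hba h
  · refine le_trans ?_ (aux_large_half (b := 1/2) (by norm_num) (h.trans hba) le_rfl)
    have h0 : max (Theta (1/2) (1/2)) 0 = 0 := by norm_num [Theta]
    rw [h0]
    have h1 : 0 ≤ max (Theta b b) 0 := le_max_right _ _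
    have h2 : Theta a b ≤ Theta a (1/2) := by
      unfold Theta
      have h3 : (1/2:ℝ)^3 ≤ b^3 := by gcongr
      have h4 : b^3*(1-a-b) ≤ (1/2)^3*(1-a-1/2) := by nlinarith
      have h5 : 0 ≤ a^3 := by have : 0 ≤ a := by linarith
                              positivity
      nlinarith [mul_le_mul_of_nonneg_left h4 h5]
    linarith

lemma aux_reduce {a b : ℝ} (hb : b ∈ Icc 0 a) : ∃ c ∈ Icc 0 a, c ≤ 3/8 ∧
    Theta a b - max (Theta b b) 0 / 2 ≤ Theta a c - max (Theta c c) 0 / 2 := by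
  rcases le_total b (3/8) with h | h
  · exact ⟨b, hb, h, le_rfl⟩
  · exact ⟨3/8, ⟨by norm_num, h.trans hb.2⟩, le_rfl, aux_large h hb.2⟩

lemma aux_le_one {a b : ℝ} (ha : a ∈ Icc (0:ℝ) 1) (hb : b ∈ Icc (0:ℝ) 1) : Theta a b ≤ 1 := by
  obtain ⟨h1, h2⟩ := ha
  obtain ⟨h3, h4⟩ := hb
  have e1 : a^3 ≤ 1 := pow_le_one₀ h1 h2
  have e2 : b^3 ≤ 1 := pow_le_one₀ h3 h4
  have e3 : a^3*b^3 ≤ 1 := mul_le_one₀ e1 (by positivity) e2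
  have e4 : 0 ≤ a^3*b^3 := by positivity
  unfold Theta
  nlinarith

lemma aux_bdd {φ : ℝ → ℝ} (hφ : ∀ b ∈ Icc (0:ℝ) 1, 0 ≤ φ b) {a c : ℝ} (ha : a ∈ Icc (0:ℝ) 1)
    (hc : c ≤ 1) : BddAbove ((fun b => Theta a b - φ b) '' Icc 0 c) := by
  refine ⟨1, ?_⟩
  rintro _ ⟨b, hb, rfl⟩
  have hb' : b ∈ Icc (0:ℝ) 1 := ⟨hb.1, hb.2.trans hc⟩
  have := aux_le_one ha hb'
  have := hφ b hb'
  simp only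
  linarith

lemma aux_le {φ : ℝ → ℝ} (hφ : ∀ b ∈ Icc (0:ℝ) 1, 0 ≤ φ b) {a b c : ℝ} (ha : a ∈ Icc (0:ℝ) 1)
    (hc : c ≤ 1) (hb : b ∈ Icc 0 c) :
    Theta a b - φ b ≤ sSup ((fun b => Theta a b - φ b) '' Icc 0 c) :=
  le_csSup (aux_bdd hφ ha hc) ⟨b, hb, rfl⟩

lemma aux_sSup_le {φ : ℝ → ℝ} {a c M : ℝ} (hc : 0 ≤ c)
    (h : ∀ b ∈ Icc 0 c, Theta a b - φ b ≤ M) :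
    sSup ((fun b => Theta a b - φ b) '' Icc 0 c) ≤ M := by
  apply csSup_le ((nonempty_Icc.2 hc).image _)
  rintro _ ⟨b, hb, rfl⟩
  exact h b hb

lemma aux_g_ge {a b : ℝ} (ha : a ∈ Icc (0:ℝ) 1) (hb : b ∈ Icc 0 a) :
    Theta a b - max (Theta b b) 0 / 2 ≤ gTheta a :=
  aux_le (φ := fun b => max (Theta b b) 0 / 2)
    (fun b _ => div_nonneg (le_max_right _ _) (by norm_num)) ha ha.2 hb

lemma aux_g_le {a M : ℝ} (ha : 0 ≤ a)
    (h : ∀ b ∈ Icc 0 a, Theta a b - max (Theta b b) 0 / 2 ≤ M) : gTheta a ≤ M :=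
  aux_sSup_le (φ := fun b => max (Theta b b) 0 / 2) ha h

lemma aux_g_ge_h {a : ℝ} (ha : a ∈ Icc (0:ℝ) 1) : max (Theta a a) 0 / 2 ≤ gTheta a := by
  rcases le_total (Theta a a) 0 with h | h
  · have := aux_g_ge ha (b := 0) ⟨le_rfl, ha.1⟩
    rw [max_eq_right h]
    simpa [Theta] using this
  · have := aux_g_ge ha (b := a) ⟨ha.1, le_rfl⟩
    rw [max_eq_left h] at *
    linarith

lemma aux_g_small {a : ℝ} (ha : 0 ≤ a) (ha' : a ≤ 3/8) : gTheta a ≤ max (Theta a a) 0 / 2 :=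
  aux_g_le ha fun _ hb => aux_small hb.1 hb.2 ha'

lemma aux_g_nonneg : ∀ a ∈ Icc (0:ℝ) 1, 0 ≤ gTheta a := fun _ ha =>
  le_trans (div_nonneg (le_max_right _ _) (by norm_num)) (aux_g_ge_h ha)

/-- **Optimality of `g_Θ`** (Remark 3 of the paper): `g_Θ` is the unique nonnegative solution on
`[0,1]` of the fixed point equation `f(a) = max_{0≤b≤a} {Θ(a,b) - f(b)}`, and any nonnegative
solution of this equation also satisfies `f(a) = max_{0≤b≤1} {Θ(a,b) - f(b)}`. -/
theorem gTheta_fixed_point_unique :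
    (∀ a ∈ Icc (0:ℝ) 1, gTheta a = sSup ((fun b => Theta a b - gTheta b) '' Icc 0 a)) ∧
    (∀ f : ℝ → ℝ, (∀ a ∈ Icc (0:ℝ) 1, 0 ≤ f a) →
      (∀ a ∈ Icc (0:ℝ) 1, f a = sSup ((fun b => Theta a b - f b) '' Icc 0 a)) →
      (∀ a ∈ Icc (0:ℝ) 1, f a = gTheta a) ∧
        ∀ a ∈ Icc (0:ℝ) 1, f a = sSup ((fun b => Theta a b - f b) '' Icc 0 1)) := by
  refine ⟨fun a ha => le_antisymm ?_ ?_, fun f hf hfix => ?_⟩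
  · refine aux_g_le ha.1 fun b hb => ?_
    obtain ⟨c, hc, hc', h⟩ := aux_reduce hb
    have h1 := aux_le aux_g_nonneg ha ha.2 hc
    have h2 := aux_g_small hc.1 hc'
    linarith
  · refine aux_sSup_le ha.1 fun b hb => ?_
    have h1 := aux_g_ge ha hb
    have h2 := aux_g_ge_h (a := b) ⟨hb.1, hb.2.trans ha.2⟩
    linarith
  · have hge : ∀ a ∈ Icc (0:ℝ) 1, ∀ b ∈ Icc 0 a, Theta a b - f b ≤ f a := by
      intro a ha b hb
      have h1 := aux_le hf ha ha.2 hb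
      rwa [← hfix a ha] at h1
    have hh : ∀ a ∈ Icc (0:ℝ) 1, max (Theta a a) 0 / 2 ≤ f a := by
      intro a ha
      have h1 := hge a ha a ⟨ha.1, le_rfl⟩
      have h2 := hf a ha
      have h3 : max (Theta a a) 0 ≤ 2 * f a := max_le (by linarith) (by linarith)
      linarith
    have hle : ∀ a ∈ Icc (0:ℝ) 1, f a ≤ gTheta a := by
      intro a ha
      rw [hfix a ha]
      refine aux_sSup_le ha.1 fun b hb => ?_
      have h1 := aux_g_ge ha hb
      have h2 := hh b ⟨hb.1, hb.2.trans ha.2⟩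
      linarith
    refine ⟨fun a ha => le_antisymm (hle a ha) ?_, fun a ha => le_antisymm ?_ ?_⟩
    · refine aux_g_le ha.1 fun b hb => ?_
      obtain ⟨c, hc, hc', h⟩ := aux_reduce hb
      have h1 := hge a ha c hc
      have h2 := aux_g_small hc.1 hc'
      have h3 := hle c ⟨hc.1, hc.2.trans ha.2⟩
      linarith
    · conv_lhs => rw [hfix a ha]
      exact aux_sSup_le ha.1 fun b hb => aux_le hf ha le_rfl ⟨hb.1, hb.2.trans ha.2⟩
    · refine aux_sSup_le zero_le_one fun b hb => ?_
      rcases le_total b a with h | h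
      · exact hge a ha b ⟨hb.1, h⟩
      · have h1 := hge b hb a ⟨ha.1, h⟩
        have h2 : Theta a b = Theta b a := by unfold Theta; ring
        linarith
end
end

section
/- Let ρ > 0 and let h : ℝ³ → ℝ be a measurable function with −ρ² ≤ h(τ) ≤ 0 for all τ ∈ ℝ³ and ∫_{ℝ³} h(τ) dτ ≥ −ρ. Then (1/2) ∫_{ℝ³} h(τ) |τ|^{−1} dτ ≥ −(3/2)·(π/6)^{1/3} · ρ^{4/3}. (This is the key analytic inequality behind the Lieb–Oxford bound for translation-invariant point processes with nonpositive truncated two-point correlations, where h = ρ^{(2)} − ρ² and the integral on the left is the Jellium energy per unit volume.) -/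
open MeasureTheory ENNReal Set Metric Filter Real Topology

noncomputable section

lemma aux_radial (R : ℝ) (hR : 0 < R) :
    IntegrableOn (fun y : ℝ => y ^ 2 • max (y⁻¹ - R⁻¹) 0) (Ioi 0) ∧
    ∫ y in Ioi (0:ℝ), y ^ 2 • max (y⁻¹ - R⁻¹) 0 = R ^ 2 / 6 := by
  have e : EqOn (fun y : ℝ => y ^ 2 • max (y⁻¹ - R⁻¹) 0)
      ((Ioc 0 R).indicator (fun y => y - R⁻¹ * y ^ 2)) (Ioi 0) := by
    intro y hy
    have hy : 0 < y := hy
    by_cases hyR : y ≤ R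
    · have : R⁻¹ ≤ y⁻¹ := inv_anti₀ hy hyR
      simp only [smul_eq_mul]
      rw [indicator_of_mem (show y ∈ Ioc 0 R from ⟨hy, hyR⟩), max_eq_left (by linarith)]
      field_simp
    · have : y⁻¹ ≤ R⁻¹ := inv_anti₀ hR (by linarith)
      simp only [smul_eq_mul]
      rw [indicator_of_notMem (fun hh => hyR hh.2), max_eq_right (by linarith), mul_zero]
  have hc : IntegrableOn (fun y : ℝ => y - R⁻¹ * y ^ 2) (Ioc 0 R) :=
    (Continuous.integrableOn_Icc (by fun_prop)).mono_set Ioc_subset_Icc_self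
  constructor
  · refine IntegrableOn.congr_fun ?_ e.symm measurableSet_Ioi
    exact ((integrable_indicator_iff measurableSet_Ioc).2 hc).integrableOn
  · rw [setIntegral_congr_fun measurableSet_Ioi e, setIntegral_indicator measurableSet_Ioc,
      inter_eq_self_of_subset_right Ioc_subset_Ioi_self,
      ← intervalIntegral.integral_of_le hR.le, intervalIntegral.integral_sub
        (by apply Continuous.intervalIntegrable; fun_prop)
        (by apply Continuous.intervalIntegrable; fun_prop), intervalIntegral.integral_const_mul,
      integral_id, integral_pow]
    field_simp
    norm_num
    ring

lemma aux_ball : (volume : Measure E3).real (ball 0 1) = 4 / 3 * π := by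
  rw [Measure.real, EuclideanSpace.volume_ball_fin_three]
  rw [ENNReal.ofReal_one, one_pow, one_mul,
    ENNReal.toReal_ofReal (by have := Real.pi_pos; positivity)]
  ring

lemma aux_E3 (R : ℝ) (hR : 0 < R) :
    Integrable (fun τ : E3 => max (‖τ‖⁻¹ - R⁻¹) 0) ∧
    ∫ τ : E3, max (‖τ‖⁻¹ - R⁻¹) 0 = 2 / 3 * π * R ^ 2 := by
  obtain ⟨h1, h2⟩ := aux_radial R hR
  have d : Module.finrank ℝ E3 = 3 := by simp
  constructor
  · rw [integrable_fun_norm_addHaar (volume : Measure E3) (f := fun y => max (y⁻¹ - R⁻¹) 0), d]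
    exact h1
  · rw [integral_fun_norm_addHaar (volume : Measure E3) (fun y => max (y⁻¹ - R⁻¹) 0), d,
      aux_ball]
    norm_num only [Nat.add_one_sub_one]
    rw [h2]
    simp only [nsmul_eq_mul, smul_eq_mul]
    push_cast
    ring

/-- **Lieb–Oxford bound for gas phases** (key analytic inequality behind Corollary 1):
if `-ρ² ≤ h ≤ 0` pointwise, `h` is integrable and `∫ h ≥ -ρ`, then
`(1/2) ∫ h(τ) |τ|⁻¹ dτ ≥ -(3/2)(π/6)^{1/3} ρ^{4/3}`. -/
theorem jellium_lower_bound (ρ : ℝ) (hρ : 0 < ρ) (h : E3 → ℝ) (hm : Measurable h)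
    (hlb : ∀ τ, -ρ ^ 2 ≤ h τ) (hub : ∀ τ, h τ ≤ 0) (hint : Integrable h volume)
    (hmean : -ρ ≤ ∫ τ, h τ) :
    (1/2) * ∫ τ : E3, h τ * ‖τ‖⁻¹ ≥ -(3/2) * (π/6) ^ ((1:ℝ)/3) * ρ ^ ((4:ℝ)/3) := by
  have hπ := Real.pi_pos
  by_cases hI : Integrable (fun τ : E3 => h τ * ‖τ‖⁻¹)
  swap
  · rw [integral_undef hI]
    have : 0 ≤ (π/6) ^ ((1:ℝ)/3) * ρ ^ ((4:ℝ)/3) := by positivity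
    nlinarith
  set a := (π/6) ^ ((1:ℝ)/3) with ha
  set b := ρ ^ ((1:ℝ)/3) with hb
  have ha0 : 0 < a := by positivity
  have hb0 : 0 < b := by positivity
  have ha3 : a ^ 3 = π / 6 := by
    rw [ha, ← Real.rpow_natCast, ← Real.rpow_mul (by positivity)]; norm_num
  have hb3 : b ^ 3 = ρ := by
    rw [hb, ← Real.rpow_natCast, ← Real.rpow_mul (by positivity)]; norm_num
  have hb4 : ρ ^ ((4:ℝ)/3) = b ^ 4 := by
    rw [hb, ← Real.rpow_natCast, ← Real.rpow_mul (by positivity)]; norm_num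
  rw [hb4]
  -- R = 1 / (2 a b)
  have hR : 0 < (2 * a * b)⁻¹ := by positivity
  obtain ⟨g1, g2⟩ := aux_E3 _ hR
  rw [inv_inv] at g1 g2
  have key : ∫ τ : E3, (h τ * (2 * a * b) - ρ ^ 2 * max (‖τ‖⁻¹ - 2 * a * b) 0)
      ≤ ∫ τ : E3, h τ * ‖τ‖⁻¹ := by
    refine integral_mono ((hint.mul_const _).sub (g1.const_mul _)) hI fun τ => ?_
    have h1 := hlb τ
    have h2 := hub τ
    simp only
    rcases le_total (‖τ‖⁻¹ - 2 * a * b) 0 with h3 | h3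
    · rw [max_eq_right h3]; nlinarith
    · rw [max_eq_left h3]; nlinarith
  rw [integral_sub (hint.mul_const _) (g1.const_mul _), integral_mul_const, integral_const_mul,
    g2] at key
  have e1 : ρ ^ 2 * (2 / 3 * π * (2 * a * b)⁻¹ ^ 2) = a * b ^ 4 := by
    have : π = 6 * a ^ 3 := by linarith
    rw [this, ← hb3]
    field_simp
    norm_num
  have e2 : -ρ * (2 * a * b) ≤ (∫ τ, h τ) * (2 * a * b) :=
    mul_le_mul_of_nonneg_right hmean (by positivity)
  have e3 : -ρ * (2 * a * b) = - 2 * (a * b ^ 4) := by rw [← hb3]; ring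
  linarith
end
end
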